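/- Let A and B be finite-dimensional complex vector spaces, let u_1, ..., u_r ∈ A and v_1, ..., v_r ∈ B be families of vectors with Kruskal ranks k_A and k_B respectively, and let c_1, ..., c_r ∈ ℂ with n = #{i : c_i ≠ 0}. Then the rank of the tensor ∑_{i=1}^r c_i u_i⊗v_i ∈ A⊗B (equivalently, the rank of the corresponding linear map B* → A) is at least min(k_A, n) + min(k_B, n) − n. -/

import Mathlib

open TensorProduct

/-- Kruskal rank: the largest `k` such that every `k`-element subfamily is linearly independent. -/
noncomputable def kruskalRank {V : Type*} [AddCommGroup V] [Module ℂ V]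
    {r : ℕ} (u : Fin r → V) : ℕ :=
  sSup {k | k ≤ r ∧ ∀ s : Finset (Fin r), s.card = k →
    LinearIndependent ℂ (fun i : {x // x ∈ s} => u i)}

/-- Tensor rank in a two-factor tensor product: the smallest `m` such that the tensor is
a sum of `m` simple tensors. -/
noncomputable def tensorRank2 {A B : Type*} [AddCommGroup A] [Module ℂ A]
    [AddCommGroup B] [Module ℂ B] (T : A ⊗[ℂ] B) : ℕ :=
  sInf {m | ∃ (a : Fin m → A) (b : Fin m → B), T = ∑ i, a i ⊗ₜ[ℂ] b i}

theorem kruskalRank_mem {V : Type*} [AddCommGroup V] [Module ℂ V] {r : ℕ} (u : Fin r → V) :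
    kruskalRank u ≤ r ∧ ∀ s : Finset (Fin r), s.card = kruskalRank u →
      LinearIndependent ℂ (fun i : {x // x ∈ s} => u i) := by
  refine Nat.sSup_mem (s := {k | k ≤ r ∧ ∀ s : Finset (Fin r), s.card = k →
    LinearIndependent ℂ (fun i : {x // x ∈ s} => u i)}) ⟨0, Nat.zero_le _, ?_⟩
    ⟨r, fun _ hk => hk.1⟩
  intro s hs
  obtain rfl := Finset.card_eq_zero.mp hs
  exact linearIndependent_empty_type

/-- A finset of indices contains an independent subfamily whose size is the minimum of the
Kruskal rank and its own cardinality. -/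
theorem exists_subset_linearIndependent_of_kruskalRank {V : Type*} [AddCommGroup V] [Module ℂ V]
    {r : ℕ} (u : Fin r → V) (S : Finset (Fin r)) :
    ∃ t ⊆ S, t.card = min (kruskalRank u) S.card ∧
      LinearIndependent ℂ (fun i : {x // x ∈ t} => u i) := by
  obtain ⟨hr, hu⟩ := kruskalRank_mem u
  obtain ⟨t, htS, ht⟩ := Finset.exists_subset_card_eq (min_le_right (kruskalRank u) S.card)
  obtain ⟨t', htt', ht'⟩ := Finset.exists_superset_card_eq (s := t) (n := kruskalRank u)
    (ht ▸ min_le_left _ _) (by simpa using hr)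
  exact ⟨t, htS, ht, (hu t' ht').comp (Set.inclusion htt') (Set.inclusion_injective htt')⟩

theorem LinearMap.finrank_range_le_finrank_range_comp_add_finrank_ker {K U V W : Type*} [Field K]
    [AddCommGroup U] [Module K U] [AddCommGroup V] [Module K V] [AddCommGroup W] [Module K W]
    [FiniteDimensional K V] (g : V →ₗ[K] W) (f : U →ₗ[K] V) :
    Module.finrank K f.range ≤ Module.finrank K (g ∘ₗ f).range + Module.finrank K g.ker := by
  have h := (g.domRestrict f.range).finrank_range_add_finrank_ker
  have hrange : (g.domRestrict f.range).range = (g ∘ₗ f).range := by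
    rw [LinearMap.range_domRestrict, LinearMap.range_comp]
  have hker : Module.finrank K (g.domRestrict f.range).ker ≤ Module.finrank K g.ker := by
    rw [← Submodule.finrank_map_subtype_eq]
    refine Submodule.finrank_mono ?_
    rintro _ ⟨x, hx, rfl⟩
    exact hx
  rw [hrange] at h
  lia

/-- A linearly independent finite family is separated by functionals with arbitrary values. -/
theorem LinearIndependent.exists_dual_apply_eq {K V ι : Type*} [Field K] [AddCommGroup V]
    [Module K V] [Fintype ι] {u : ι → V} (hu : LinearIndependent K u) (x : ι → K) :
    ∃ f : Module.Dual K V, ∀ i, f (u i) = x i := by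
  classical
  obtain ⟨g, hg⟩ := (Fintype.linearCombination K u).exists_leftInverse_of_injective
    (LinearMap.ker_eq_bot.mpr hu.fintypeLinearCombination_injective)
  refine ⟨Fintype.linearCombination K x ∘ₗ g, fun i => ?_⟩
  have h : g (u i) = Pi.single i 1 := by
    simpa using LinearMap.congr_fun hg (Pi.single i 1)
  simp [h]

/-- The linear map `A* → B` associated with a tensor in `A ⊗ B`. -/
noncomputable def tensorToDualHom (A B : Type*) [AddCommGroup A] [Module ℂ A]
    [AddCommGroup B] [Module ℂ B] : A ⊗[ℂ] B →ₗ[ℂ] Module.Dual ℂ A →ₗ[ℂ] B :=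
  dualTensorHom ℂ (Module.Dual ℂ A) B ∘ₗ (Module.Dual.eval ℂ A).rTensor B

@[simp]
theorem tensorToDualHom_tmul {A B : Type*} [AddCommGroup A] [Module ℂ A]
    [AddCommGroup B] [Module ℂ B] (a : A) (b : B) (f : Module.Dual ℂ A) :
    tensorToDualHom A B (a ⊗ₜ[ℂ] b) f = f a • b := by
  simp [tensorToDualHom]

theorem finrank_range_tensorToDualHom_sum_le {A B : Type*} [AddCommGroup A] [Module ℂ A]
    [AddCommGroup B] [Module ℂ B] {m : ℕ} (a : Fin m → A) (b : Fin m → B) :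
    Module.finrank ℂ (tensorToDualHom A B (∑ i, a i ⊗ₜ[ℂ] b i)).range ≤ m := by
  have hle : (tensorToDualHom A B (∑ i, a i ⊗ₜ[ℂ] b i)).range ≤
      Submodule.span ℂ (Set.range b) := by
    rintro _ ⟨f, rfl⟩
    simp only [map_sum, LinearMap.sum_apply, tensorToDualHom_tmul]
    exact Submodule.sum_mem _ fun i _ =>
      Submodule.smul_mem _ _ (Submodule.subset_span (Set.mem_range_self i))
  have := FiniteDimensional.span_of_finite ℂ (Set.finite_range b)
  calc _ ≤ _ := Submodule.finrank_mono hle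
    _ ≤ m := by simpa [Set.finrank] using finrank_range_le_card (R := ℂ) b

theorem finrank_range_tensorToDualHom_le_tensorRank2 {A B : Type*} [AddCommGroup A] [Module ℂ A]
    [AddCommGroup B] [Module ℂ B] (T : A ⊗[ℂ] B) :
    Module.finrank ℂ (tensorToDualHom A B T).range ≤ tensorRank2 T := by
  refine le_csInf ?_ ?_
  · obtain ⟨s, rfl⟩ := TensorProduct.exists_multiset T
    induction s using Quotient.inductionOn with
    | _ l =>
      refine ⟨l.length, fun i => (l.get i).1, fun i => (l.get i).2, ?_⟩
      simpa [← List.sum_ofFn] using congrArg List.sum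
        (List.ofFn_getElem_eq_map l fun p => p.1 ⊗ₜ[ℂ] p.2).symm
  · rintro m ⟨a, b, rfl⟩
    exact finrank_range_tensorToDualHom_sum_le a b

/-- The rank of `∑ cᵢ uᵢ ⊗ vᵢ` is at least `min(k_A, n) + min(k_B, n) − n`, where
`k_A, k_B` are the Kruskal ranks of the families `(uᵢ)`, `(vᵢ)` and `n` is the number of
nonzero coefficients `cᵢ`. -/
theorem rank_lower_bound_of_kruskal {A B : Type*}
    [AddCommGroup A] [Module ℂ A] [AddCommGroup B] [Module ℂ B]
    [FiniteDimensional ℂ A] [FiniteDimensional ℂ B]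
    {r : ℕ} (u : Fin r → A) (v : Fin r → B) (c : Fin r → ℂ)
    {n : ℕ} (hn : n = {i | c i ≠ 0}.ncard) :
    min (kruskalRank u) n + min (kruskalRank v) n - n ≤
      tensorRank2 (∑ i, c i • (u i ⊗ₜ[ℂ] v i)) := by
  classical
  set S : Finset (Fin r) := Finset.univ.filter fun i => c i ≠ 0 with hS
  have hcard : S.card = n := by
    rw [hn, Set.ncard_eq_toFinset_card']
    simp [hS]
  have hc : ∀ i : S, c i ≠ 0 := fun i => (Finset.mem_filter.mp i.2).2
  obtain ⟨s, hsS, hs, hus⟩ := exists_subset_linearIndependent_of_kruskalRank u S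
  obtain ⟨t, htS, ht, hvt⟩ := exists_subset_linearIndependent_of_kruskalRank v S
  rw [hcard] at hs ht
  let E : Module.Dual ℂ A →ₗ[ℂ] S → ℂ :=
    LinearMap.pi fun i => c i • Module.Dual.eval ℂ A (u i)
  let F : (S → ℂ) →ₗ[ℂ] B := Fintype.linearCombination ℂ fun i : S => v i
  have hFE : tensorToDualHom A B (∑ i, c i • (u i ⊗ₜ[ℂ] v i)) = F ∘ₗ E := by
    ext f
    have hsum : ∑ i ∈ S, (c i * f (u i)) • v i = ∑ i, (c i * f (u i)) • v i :=
      Finset.sum_subset (Finset.subset_univ S) fun i _ hi => by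
        have : c i = 0 := by simpa [hS] using hi
        simp [this]
    rw [← Finset.sum_coe_sort] at hsum
    simpa [E, F, Fintype.linearCombination_apply, mul_smul] using hsum.symm
  have hE : s.card ≤ Module.finrank ℂ E.range := by
    let P : (S → ℂ) →ₗ[ℂ] s → ℂ := LinearMap.funLeft ℂ ℂ (Set.inclusion hsS)
    have hsurj : Function.Surjective (P.domRestrict E.range) := by
      intro x
      obtain ⟨f, hf⟩ := hus.exists_dual_apply_eq fun i => (c i)⁻¹ * x i
      refine ⟨⟨E f, f, rfl⟩, funext fun i => ?_⟩
      have hci : c i ≠ 0 := hc ⟨i, hsS i.2⟩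
      simp [P, E, LinearMap.funLeft_apply, hf, hci]
    simpa using LinearMap.finrank_le_finrank_of_surjective hsurj
  have hF : t.card ≤ Module.finrank ℂ F.range := by
    have hspan := finrank_span_eq_card hvt
    rw [Fintype.card_coe] at hspan
    rw [← hspan]
    refine Submodule.finrank_mono (Submodule.span_le.mpr ?_)
    rintro _ ⟨i, rfl⟩
    exact ⟨Pi.single ⟨i, htS i.2⟩ 1, by simp [F]⟩
  have hker := F.finrank_range_add_finrank_ker
  rw [Module.finrank_fintype_fun_eq_card, Fintype.card_coe, hcard] at hker
  have hcomp := F.finrank_range_le_finrank_range_comp_add_finrank_ker E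
  have hrank := finrank_range_tensorToDualHom_le_tensorRank2 (∑ i, c i • (u i ⊗ₜ[ℂ] v i))
  rw [hFE] at hrank
  lia
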